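/- Let τ be in the complex upper half-plane and let u ∈ ℂ with u ∉ ℤτ+ℤ. Then ϑ(u;τ)³ · (12πi ∂/∂τ + ∂²/∂u²)[ e^{πiu − πiτ/12} R*(e^{2πiu}; e^{2πiτ}) ] = −8π² i η(τ)⁸, where the differential operator is applied to the bracketed expression as a function of (u,τ). -/

import Mathlib

open Complex Real Filter

noncomputable section

/-- The Jacobi theta function ϑ(u;τ) = Σ_{ν∈ℤ+1/2} e^{πiν²τ + 2πiν(u+1/2)}. -/
def jTheta (u τ : ℂ) : ℂ :=
  ∑' n : ℤ, Complex.exp (π * I * ((n : ℂ) + 1/2)^2 * τ + 2 * π * I * ((n : ℂ) + 1/2) * (u + 1/2))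

/-- ϑ₀(u;τ) = Σ_{n∈ℤ} e^{πin²τ + 2πinu}. -/
def jTheta0 (u τ : ℂ) : ℂ :=
  ∑' n : ℤ, Complex.exp (π * I * (n : ℂ)^2 * τ + 2 * π * I * (n : ℂ) * u)

/-- ϑ₁(u;τ) = Σ_{n∈1/2+ℤ} e^{πin²τ + 2πinu}. -/
def jTheta1 (u τ : ℂ) : ℂ :=
  ∑' n : ℤ, Complex.exp (π * I * ((n : ℂ) + 1/2)^2 * τ + 2 * π * I * ((n : ℂ) + 1/2) * u)

/-- The Dedekind eta function. -/
def dedekindEta (τ : ℂ) : ℂ :=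
  Complex.exp (π * I * τ / 12) * ∏' n : ℕ, (1 - Complex.exp (2 * π * I * ((n : ℂ) + 1) * τ))

/-- The Lerch sum μ(u,v;τ). -/
def lerchMu (u v τ : ℂ) : ℂ :=
  Complex.exp (π * I * u) / jTheta v τ *
    ∑' n : ℤ, (-1 : ℂ) ^ n * Complex.exp (π * I * ((n : ℂ)^2 + (n : ℂ)) * τ + 2 * π * I * v * (n : ℂ)) /
      (1 - Complex.exp (2 * π * I * (n : ℂ) * τ + 2 * π * I * u))

/-- a₀^{α,β}(τ). -/
def aCoef0 (α β : ℝ) (τ : ℂ) : ℂ :=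
  ∑' n : ℤ, ((n : ℂ) + (α : ℂ)/2) *
    Complex.exp (2 * π * I * (n : ℂ)^2 * τ + 2 * π * I * (n : ℂ) * ((α : ℂ) * τ + (β : ℂ)))

/-- a₁^{α,β}(τ). -/
def aCoef1 (α β : ℝ) (τ : ℂ) : ℂ :=
  ∑' n : ℤ, (((n : ℂ) + 1/2) + (α : ℂ)/2) *
    Complex.exp (2 * π * I * ((n : ℂ) + 1/2)^2 * τ + 2 * π * I * ((n : ℂ) + 1/2) * ((α : ℂ) * τ + (β : ℂ)))

/-- Finite q-Pochhammer symbol (a;q)_n. -/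
def qPochN (a q : ℂ) (n : ℕ) : ℂ := ∏ j ∈ Finset.range n, (1 - a * q ^ j)

/-- Infinite q-Pochhammer symbol (a;q)_∞. -/
def qPochInf (a q : ℂ) : ℂ := ∏' j : ℕ, (1 - a * q ^ j)

/-- The modified rank generating function R*(z;q). -/
def rankStar (z q : ℂ) : ℂ :=
  (qPochInf q q)⁻¹ * ∑' n : ℤ, (-1 : ℂ) ^ n * q ^ (n * (3 * n + 1) / 2) / (1 - z * q ^ n)

/-- The modified crank generating function C*(z;q). -/
def crankStar (z q : ℂ) : ℂ :=
  (1 - z)⁻¹ * ∏' n : ℕ, ((1 - q ^ (n + 1)) / ((1 - z * q ^ (n + 1)) * (1 - z⁻¹ * q ^ (n + 1))))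

/-- N(1,0,z;q), the overpartition-rank generating function. -/
def nGen10 (z q : ℂ) : ℂ :=
  ∑' n : ℕ, qPochN (-1) q n * q ^ (n * (n + 1) / 2) / (qPochN (z * q) q n * qPochN (z⁻¹ * q) q n)

/-- N*(1,0,z;q). -/
def nStar10 (z q : ℂ) : ℂ := nGen10 z q / (1 - z)

/-- N(1,1/q,z;q²), the M2-rank generating function for overpartitions. -/
def nGenM2over (z q : ℂ) : ℂ :=
  ∑' n : ℕ, qPochN (-1) (q^2) n * qPochN (-q) (q^2) n * q ^ n /
    (qPochN (z * q^2) (q^2) n * qPochN (z⁻¹ * q^2) (q^2) n)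

/-- N*(1,1/q,z;q²). -/
def nStarM2over (z q : ℂ) : ℂ := nGenM2over z q / (1 - z)

/-- N(0,1/q,z;q²), the M2-rank generating function for partitions without repeated odd parts. -/
def nGenM2 (z q : ℂ) : ℂ :=
  ∑' n : ℕ, qPochN (-q) (q^2) n * q ^ (n^2) /
    (qPochN (z * q^2) (q^2) n * qPochN (z⁻¹ * q^2) (q^2) n)

/-- N*(0,1/q,z;q²). -/
def nStarM2 (z q : ℂ) : ℂ := nGenM2 z q / (1 - z)

/-- The odd-rank generating function R^o(z;q). -/
def oddRank (z q : ℂ) : ℂ :=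
  (qPochInf (q^2) (q^2))⁻¹ * ∑' n : ℤ, (-1 : ℂ) ^ n * q ^ (3 * n^2 + 3 * n + 1) / (1 - z * q ^ (2 * n + 1))


/-- The reciprocal of the `q`-factorial `(q;q)_n`, extended by zero to negative integers. -/
def invQFactorial (q : ℂ) (n : ℤ) : ℂ := if n < 0 then 0 else (qPochN q q n.toNat)⁻¹

/-- The Gaussian binomial coefficient `[2N, N + k]_q`, zero for `|k| > N`. -/
def centralQBinom (q : ℂ) (N : ℕ) (k : ℤ) : ℂ :=
  qPochN q q (2 * N) * invQFactorial q (N + k) * invQFactorial q (N - k)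

section QSeries

variable {q : ℂ}

lemma one_sub_pow_succ_ne_zero (hq : ‖q‖ < 1) (n : ℕ) : 1 - q ^ (n + 1) ≠ 0 := by
  intro h
  have h1 : ‖q ^ (n + 1)‖ = 1 := by rw [← sub_eq_zero.mp h, norm_one]
  rw [norm_pow] at h1
  exact (pow_lt_one₀ (norm_nonneg q) hq n.succ_ne_zero).ne h1

lemma qPochN_self_eq (q : ℂ) (n : ℕ) : qPochN q q n = ∏ j ∈ Finset.range n, (1 - q ^ (j + 1)) := by
  simp [qPochN, pow_succ']

lemma qPochInf_self_eq (q : ℂ) : qPochInf q q = ∏' j : ℕ, (1 - q ^ (j + 1)) := by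
  simp [qPochInf, pow_succ']

lemma qPochN_self_succ (q : ℂ) (n : ℕ) :
    qPochN q q (n + 1) = qPochN q q n * (1 - q ^ (n + 1)) := by
  simp [qPochN_self_eq, Finset.prod_range_succ]

lemma qPochN_self_ne_zero (hq : ‖q‖ < 1) (n : ℕ) : qPochN q q n ≠ 0 := by
  rw [qPochN_self_eq]
  exact Finset.prod_ne_zero_iff.mpr fun j _ => one_sub_pow_succ_ne_zero hq j

lemma qPochInf_self_ne_zero (hq : ‖q‖ < 1) : qPochInf q q ≠ 0 := by
  rw [qPochInf_self_eq]
  simp_rw [sub_eq_add_neg]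
  refine tprod_one_add_ne_zero_of_summable (f := fun n : ℕ => -q ^ (n + 1)) (fun j => ?_) ?_
  · simpa [sub_eq_add_neg] using one_sub_pow_succ_ne_zero hq j
  · simpa using (summable_nat_add_iff 1).mpr (summable_geometric_of_lt_one (norm_nonneg q) hq)

lemma tendsto_qPochN_self (hq : ‖q‖ < 1) :
    Tendsto (qPochN q q) atTop (nhds (qPochInf q q)) := by
  rw [qPochInf_self_eq]
  refine (ModularForm.multipliable_one_sub_pow hq).hasProd.tendsto_prod_nat.congr fun n => ?_
  rw [qPochN_self_eq]

lemma invQFactorial_natCast (q : ℂ) (n : ℕ) : invQFactorial q n = (qPochN q q n)⁻¹ := by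
  simp [invQFactorial]

lemma invQFactorial_of_neg (q : ℂ) {n : ℤ} (hn : n < 0) : invQFactorial q n = 0 := by
  simp [invQFactorial, hn]

lemma invQFactorial_sub_one (hq : ‖q‖ < 1) (n : ℤ) :
    invQFactorial q (n - 1) = (1 - q ^ n) * invQFactorial q n := by
  rcases lt_trichotomy n 0 with hn | rfl | hn
  · rw [invQFactorial_of_neg q hn, invQFactorial_of_neg q (by omega), mul_zero]
  · simp [invQFactorial]
  · obtain ⟨m, rfl⟩ : ∃ m : ℕ, n = (m : ℤ) + 1 := ⟨(n - 1).toNat, by omega⟩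
    have h := one_sub_pow_succ_ne_zero hq m
    rw [add_sub_cancel_right, ← Nat.cast_succ, invQFactorial_natCast, invQFactorial_natCast,
      Nat.succ_eq_add_one, qPochN_self_succ, zpow_natCast, mul_inv]
    field_simp

lemma centralQBinom_zero (q : ℂ) (k : ℤ) : centralQBinom q 0 k = if k = 0 then 1 else 0 := by
  rcases lt_trichotomy k 0 with hk | rfl | hk
  · simp [centralQBinom, hk.ne, invQFactorial_of_neg q hk]
  · simp [centralQBinom, invQFactorial, qPochN]
  · simp [centralQBinom, hk.ne', invQFactorial_of_neg q (neg_lt_zero.mpr hk)]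

lemma centralQBinom_succ (hq : ‖q‖ < 1) (hq0 : q ≠ 0) (N : ℕ) (k : ℤ) :
    centralQBinom q (N + 1) k = (1 + q ^ (2 * N + 1)) * centralQBinom q N k +
      q ^ ((N : ℤ) + 1 - k) * centralQBinom q N (k - 1) +
      q ^ ((N : ℤ) + 1 + k) * centralQBinom q N (k + 1) := by
  have e1 : q ^ (2 * N + 1) = q ^ ((N : ℤ) + k) * q ^ ((N : ℤ) - k) * q := by
    rw [← zpow_add₀ hq0, ← zpow_add_one₀ hq0, ← zpow_natCast]; congr 1; push_cast; ring
  have e2 : q ^ (2 * N + 2) = q ^ ((N : ℤ) + k) * q ^ ((N : ℤ) - k) * q * q := by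
    rw [pow_succ, e1]
  have e3 : q ^ ((N : ℤ) + 1 + k) = q ^ ((N : ℤ) + k) * q := by
    rw [← zpow_add_one₀ hq0]; congr 1; ring
  have e4 : q ^ ((N : ℤ) + 1 - k) = q ^ ((N : ℤ) - k) * q := by
    rw [← zpow_add_one₀ hq0]; congr 1; ring
  have a1 : invQFactorial q (N + k) = (1 - q ^ ((N : ℤ) + 1 + k)) *
      invQFactorial q (N + 1 + k) := by
    rw [← invQFactorial_sub_one hq]; congr 1; ring
  have a2 : invQFactorial q (N + (k - 1)) = (1 - q ^ ((N : ℤ) + k)) *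
      invQFactorial q (N + k) := by
    rw [← invQFactorial_sub_one hq]; congr 1; ring
  have b1 : invQFactorial q (N - k) = (1 - q ^ ((N : ℤ) + 1 - k)) *
      invQFactorial q (N + 1 - k) := by
    rw [← invQFactorial_sub_one hq]; congr 1; ring
  have b2 : invQFactorial q (N - (k + 1)) = (1 - q ^ ((N : ℤ) - k)) *
      invQFactorial q (N - k) := by
    rw [← invQFactorial_sub_one hq]; congr 1; ring
  have a3 : (N : ℤ) + (k + 1) = N + 1 + k := by ring
  have b3 : (N : ℤ) - (k - 1) = N + 1 - k := by ring
  have hP : qPochN q q (2 * (N + 1)) =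
      qPochN q q (2 * N) * (1 - q ^ (2 * N + 1)) * (1 - q ^ (2 * N + 2)) := by
    rw [show 2 * (N + 1) = 2 * N + 1 + 1 by ring, qPochN_self_succ, qPochN_self_succ]
  unfold centralQBinom
  rw [hP, a2, b2, a1, b1, a3, b3, e1, e2, e3, e4]
  push_cast
  ring

/-- The general term of the finite Jacobi triple product. -/
def tripleTerm (q z : ℂ) (k : ℤ) : ℂ := (-1) ^ k * q ^ (k * (k + 1) / 2) * z ^ k

lemma tripleTerm_sub_one (hq0 : q ≠ 0) {z : ℂ} (hz : z ≠ 0) (k : ℤ) :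
    tripleTerm q z (k - 1) * z * q ^ k = -tripleTerm q z k := by
  have h : k * (k + 1) / 2 = (k - 1) * (k - 1 + 1) / 2 + k := by
    rw [show k * (k + 1) = (k - 1) * (k - 1 + 1) + k * 2 by ring, Int.add_mul_ediv_right _ _ two_ne_zero]
  rw [tripleTerm, tripleTerm, h, zpow_add₀ hq0, zpow_sub_one₀ hz,
    zpow_sub_one₀ (by norm_num : (-1 : ℂ) ≠ 0)]
  field_simp

lemma tripleTerm_mul_centralQBinom_succ (hq : ‖q‖ < 1) (hq0 : q ≠ 0) {z : ℂ} (hz : z ≠ 0)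
    (N : ℕ) (k : ℤ) :
    tripleTerm q z k * centralQBinom q (N + 1) k =
      (1 + q ^ (2 * N + 1)) * (tripleTerm q z k * centralQBinom q N k) -
      z * q ^ (N + 1) * (tripleTerm q z (k - 1) * centralQBinom q N (k - 1)) -
      z⁻¹ * q ^ N * (tripleTerm q z (k + 1) * centralQBinom q N (k + 1)) := by
  have h1 := tripleTerm_sub_one hq0 hz k
  have h2 := tripleTerm_sub_one hq0 hz (k + 1)
  rw [add_sub_cancel_right] at h2
  have h1' : tripleTerm q z k * q ^ ((N : ℤ) + 1 - k) = -(z * q ^ (N + 1) *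
      tripleTerm q z (k - 1)) := by
    rw [← neg_eq_iff_eq_neg.mpr h1, zpow_sub₀ hq0]
    have := zpow_ne_zero k hq0
    field_simp
    norm_cast
  have h2' : tripleTerm q z k * q ^ ((N : ℤ) + 1 + k) = -(z⁻¹ * q ^ N *
      tripleTerm q z (k + 1)) := by
    rw [← neg_eq_iff_eq_neg.mpr h2, show (N : ℤ) + 1 + k = N + (k + 1) by ring, zpow_add₀ hq0]
    field_simp
    norm_cast
  rw [centralQBinom_succ hq hq0]
  linear_combination centralQBinom q N (k - 1) * h1' + centralQBinom q N (k + 1) * h2'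

/-- The finite form of the Jacobi triple product identity. -/
lemma hasSum_finite_tripleProduct (hq : ‖q‖ < 1) (hq0 : q ≠ 0) {z : ℂ} (hz : z ≠ 0) (N : ℕ) :
    HasSum (fun k : ℤ => tripleTerm q z k * centralQBinom q N k)
      (∏ j ∈ Finset.range N, ((1 - z * q ^ (j + 1)) * (1 - z⁻¹ * q ^ j))) := by
  induction N with
  | zero =>
    convert hasSum_single (0 : ℤ) _ using 1
    · simp [tripleTerm, centralQBinom_zero]
    · intro k hk
      simp [centralQBinom_zero, hk]
  | succ N ih =>
    have hl := (Equiv.subRight (1 : ℤ)).hasSum_iff.mpr ih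
    have hr := (Equiv.addRight (1 : ℤ)).hasSum_iff.mpr ih
    convert! ((ih.mul_left (1 + q ^ (2 * N + 1))).sub (hl.mul_left (z * q ^ (N + 1)))).sub
      (hr.mul_left (z⁻¹ * q ^ N)) using 1
    · funext k
      simpa using tripleTerm_mul_centralQBinom_succ hq hq0 hz N k
    · rw [Finset.prod_range_succ]
      field_simp
      ring

/-- The finite form of Jacobi's identity for the cube of the Euler function. -/
lemma hasSum_finite_jacobi (hq : ‖q‖ < 1) (hq0 : q ≠ 0) (N : ℕ) :
    HasSum (fun k : ℤ => k * (tripleTerm q 1 k * centralQBinom q (N + 1) k))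
      (qPochN q q (N + 1) * qPochN q q N) := by
  have hstep (M : ℕ) {D : ℂ}
      (hD : HasSum (fun k : ℤ => k * (tripleTerm q 1 k * centralQBinom q M k)) D) :
      HasSum (fun k : ℤ => k * (tripleTerm q 1 k * centralQBinom q (M + 1) k))
        ((1 + q ^ (2 * M + 1)) * D -
          q ^ (M + 1) * (D + ∏ j ∈ Finset.range M, ((1 - q ^ (j + 1)) * (1 - q ^ j))) -
          q ^ M * (D - ∏ j ∈ Finset.range M, ((1 - q ^ (j + 1)) * (1 - q ^ j)))) := by
    have hP := hasSum_finite_tripleProduct hq hq0 one_ne_zero M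
    simp only [inv_one, one_mul] at hP
    have hl := (Equiv.subRight (1 : ℤ)).hasSum_iff.mpr (hD.add hP)
    have hr := (Equiv.addRight (1 : ℤ)).hasSum_iff.mpr (hD.sub hP)
    convert! ((hD.mul_left (1 + q ^ (2 * M + 1))).sub (hl.mul_left (q ^ (M + 1)))).sub
      (hr.mul_left (q ^ M)) using 1
    funext k
    rw [tripleTerm_mul_centralQBinom_succ hq hq0 one_ne_zero]
    simp
    ring
  induction N with
  | zero =>
    convert hstep 0 (D := 0) ?_ using 1
    · simp [qPochN]
      ring
    · convert hasSum_zero using 2 with k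
      by_cases hk : k = 0 <;> simp [centralQBinom_zero, hk]
  | succ N ih =>
    convert hstep (N + 1) ih using 1
    have h0 : ∏ j ∈ Finset.range (N + 1), ((1 - q ^ (j + 1)) * (1 - q ^ j)) = 0 :=
      Finset.prod_eq_zero (Finset.mem_range.mpr N.succ_pos) (by simp)
    rw [h0, qPochN_self_succ q (N + 1), qPochN_self_succ q N]
    ring

lemma tendsto_invQFactorial (hq : ‖q‖ < 1) :
    Tendsto (invQFactorial q) atTop (nhds (qPochInf q q)⁻¹) := by
  rw [← Nat.map_cast_int_atTop, tendsto_map'_iff]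
  refine ((tendsto_qPochN_self hq).inv₀ (qPochInf_self_ne_zero hq)).congr fun n => ?_
  simp [invQFactorial_natCast]

lemma tendsto_centralQBinom (hq : ‖q‖ < 1) (k : ℤ) :
    Tendsto (fun N : ℕ => centralQBinom q N k) atTop (nhds (qPochInf q q)⁻¹) := by
  have h1 : Tendsto (fun N : ℕ => 2 * N) atTop atTop :=
    tendsto_id.const_mul_atTop' (by norm_num)
  have h2 : Tendsto (fun N : ℕ => (N : ℤ) + k) atTop atTop :=
    tendsto_atTop_add_const_right _ _ tendsto_natCast_atTop_atTop
  have h3 : Tendsto (fun N : ℕ => (N : ℤ) - k) atTop atTop := by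
    simpa [sub_eq_add_neg] using
      tendsto_atTop_add_const_right _ (-k) (tendsto_natCast_atTop_atTop (R := ℤ))
  have := (((tendsto_qPochN_self hq).comp h1).mul ((tendsto_invQFactorial hq).comp h2)).mul
    ((tendsto_invQFactorial hq).comp h3)
  rw [mul_inv_cancel₀ (qPochInf_self_ne_zero hq), one_mul] at this
  exact this

lemma exists_norm_centralQBinom_le (hq : ‖q‖ < 1) :
    ∃ C : ℝ, ∀ (N : ℕ) (k : ℤ), ‖centralQBinom q N k‖ ≤ C := by
  obtain ⟨A, hA⟩ := (Metric.isBounded_range_of_tendsto _ (tendsto_qPochN_self hq)).exists_norm_le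
  obtain ⟨B, hB⟩ := (Metric.isBounded_range_of_tendsto _
    ((tendsto_qPochN_self hq).inv₀ (qPochInf_self_ne_zero hq))).exists_norm_le
  have hB0 : 0 ≤ B := (norm_nonneg _).trans (hB _ ⟨0, rfl⟩)
  have hA0 : 0 ≤ A := (norm_nonneg _).trans (hA _ ⟨0, rfl⟩)
  have hinv (n : ℤ) : ‖invQFactorial q n‖ ≤ B := by
    rw [invQFactorial]
    split_ifs
    · simpa using hB0
    · exact hB _ ⟨_, rfl⟩
  refine ⟨A * B * B, fun N k => ?_⟩
  rw [centralQBinom, norm_mul, norm_mul]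
  gcongr
  · exact hA _ ⟨_, rfl⟩
  · exact hinv _
  · exact hinv _

lemma tendsto_tsum_mul_centralQBinom (hq : ‖q‖ < 1) {a : ℤ → ℂ} (ha : Summable a) :
    Tendsto (fun N : ℕ => ∑' k : ℤ, a k * centralQBinom q N k) atTop
      (nhds ((∑' k, a k) * (qPochInf q q)⁻¹)) := by
  obtain ⟨C, hC⟩ := exists_norm_centralQBinom_le hq
  rw [← tsum_mul_right]
  refine tendsto_tsum_of_dominated_convergence (ha.norm.mul_right C)
    (fun k => (tendsto_centralQBinom hq k).const_mul _) (Eventually.of_forall fun N k => ?_)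
  rw [norm_mul]
  gcongr
  exact hC N k

/-- **Jacobi's identity** for the cube of the Euler function. -/
lemma tsum_mul_tripleTerm_one (hq : ‖q‖ < 1) (hq0 : q ≠ 0)
    (ha : Summable fun k : ℤ => k * tripleTerm q 1 k) :
    ∑' k : ℤ, k * tripleTerm q 1 k = qPochInf q q ^ 3 := by
  have hP := qPochInf_self_ne_zero hq
  have h1 := (tendsto_tsum_mul_centralQBinom hq ha).comp (tendsto_add_atTop_nat 1)
  have h2 := ((tendsto_qPochN_self hq).comp (tendsto_add_atTop_nat 1)).mul (tendsto_qPochN_self hq)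
  have h3 := tendsto_nhds_unique h1 (h2.congr fun N => ?_)
  · field_simp at h3
    rw [h3]
  · simp only [Function.comp_apply, mul_assoc]
    rw [← (hasSum_finite_jacobi hq hq0 N).tsum_eq]

lemma qPochN_self_three_mul (q : ℂ) (N : ℕ) :
    qPochN q q (3 * N) = qPochN (q ^ 3) (q ^ 3) N *
      ∏ j ∈ Finset.range N, ((1 - q⁻¹ * (q ^ 3) ^ (j + 1)) * (1 - q⁻¹⁻¹ * (q ^ 3) ^ j)) := by
  induction N with
  | zero => simp [qPochN]
  | succ N ih =>
    rcases eq_or_ne q 0 with rfl | hq0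
    · simp [qPochN]
    have h : q⁻¹ * (q ^ 3) ^ (N + 1) = q ^ (3 * N + 1 + 1) := by
      rw [← pow_mul]; field_simp; ring
    rw [show 3 * (N + 1) = 3 * N + 1 + 1 + 1 by ring, qPochN_self_succ, qPochN_self_succ,
      qPochN_self_succ, ih, qPochN_self_succ, Finset.prod_range_succ, h]
    simp only [inv_inv]
    ring

/-- **Euler's pentagonal number theorem**. -/
lemma tsum_tripleTerm_cube (hq : ‖q‖ < 1) (hq0 : q ≠ 0)
    (ha : Summable fun k : ℤ => tripleTerm (q ^ 3) q⁻¹ k) :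
    ∑' k : ℤ, tripleTerm (q ^ 3) q⁻¹ k = qPochInf q q := by
  have hq3 : ‖q ^ 3‖ < 1 := by
    rw [norm_pow]
    exact pow_lt_one₀ (norm_nonneg _) hq three_ne_zero
  have hP := qPochInf_self_ne_zero hq3
  have h1 := tendsto_tsum_mul_centralQBinom hq3 ha
  have h2 := ((tendsto_qPochN_self hq).comp
    (tendsto_id.const_mul_atTop' (by norm_num : 0 < 3))).mul
      ((tendsto_qPochN_self hq3).inv₀ hP)
  have h3 := tendsto_nhds_unique h1 (h2.congr fun N => ?_)
  · exact mul_right_cancel₀ (inv_ne_zero hP) h3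
  · have := qPochN_self_ne_zero hq3 N
    simp only [Function.comp_apply, id, qPochN_self_three_mul]
    rw [(hasSum_finite_tripleProduct hq3 (pow_ne_zero 3 hq0) (inv_ne_zero hq0) N).tsum_eq]
    field_simp

end QSeries

section NormalConvergence

open Topology Metric ContDiff

/-- A family of functions is locally normally summable on `D` if around each point of `D` its
norms are uniformly dominated by a summable family. -/
def LocallyNormallySummableOn {ι E F : Type*} [TopologicalSpace E] [Norm F] (f : ι → E → F)
    (D : Set E) : Prop :=
  ∀ x ∈ D, ∃ U ∈ 𝓝 x, ∃ M : ι → ℝ, Summable M ∧ ∀ n, ∀ y ∈ U, ‖f n y‖ ≤ M n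

variable {ι E F : Type*} [NormedAddCommGroup F] {D : Set E}

lemma LocallyNormallySummableOn.summable [TopologicalSpace E] [CompleteSpace F] {f : ι → E → F}
    (hf : LocallyNormallySummableOn f D) {x : E} (hx : x ∈ D) : Summable fun n => f n x := by
  obtain ⟨U, hU, M, hM, hb⟩ := hf x hx
  exact Summable.of_norm_bounded hM fun n => hb n x (mem_of_mem_nhds hU)

lemma LocallyNormallySummableOn.of_cofinite [TopologicalSpace E] {f : ι → E → F}
    (hc : ∀ n, ∀ x ∈ D, ContinuousAt (f n) x)
    (hb : ∀ x ∈ D, ∃ U ∈ 𝓝 x, ∃ M : ι → ℝ, Summable M ∧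
      ∀ᶠ n in cofinite, ∀ y ∈ U, ‖f n y‖ ≤ M n) : LocallyNormallySummableOn f D := by
  classical
  intro x hx
  obtain ⟨U, hU, M, hM, hb⟩ := hb x hx
  have hfin := eventually_cofinite.mp hb
  have hV : ∀ᶠ y in 𝓝 x, ∀ n ∈ hfin.toFinset, ‖f n y‖ ≤ ‖f n x‖ + 1 :=
    (eventually_all_finset _).mpr fun n _ =>
      ((hc n x hx).norm.eventually_lt continuousAt_const (lt_add_one ‖f n x‖)).mono
        fun _ h => h.le
  refine ⟨_, inter_mem hU hV, fun n => if n ∈ hfin.toFinset then ‖f n x‖ + 1 else M n, ?_, ?_⟩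
  · refine (summable_congr_cofinite ?_).mpr hM
    filter_upwards [hfin.toFinset.finite_toSet.compl_mem_cofinite] with n hn
    exact if_neg (by simpa using hn)
  · rintro n y ⟨hyU, hyV⟩
    dsimp only
    split_ifs with hn
    · exact hyV n hn
    · have : ∀ y ∈ U, ‖f n y‖ ≤ M n := by simpa using hn
      exact this y hyU

variable [NormedAddCommGroup E] [NormedSpace ℂ E] [NormedSpace ℂ F]

lemma LocallyNormallySummableOn.fderiv {f : ι → E → F} (hf : LocallyNormallySummableOn f D)
    (hD : IsOpen D) (hd : ∀ n, DifferentiableOn ℂ (f n) D) :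
    LocallyNormallySummableOn (fun n => fderiv ℂ (f n)) D := by
  intro x hx
  obtain ⟨U, hU, M, hM, hb⟩ := hf x hx
  obtain ⟨r, hr, hball⟩ := Metric.mem_nhds_iff.mp (inter_mem hU (hD.mem_nhds hx))
  refine ⟨ball x (r / 2), ball_mem_nhds x (by positivity), fun n => (M n + M n) / (r / 2),
    (hM.add hM).div_const _, fun n y hy => ?_⟩
  have hsub : ball y (r / 2) ⊆ ball x r := ball_subset_ball' (by
    have := mem_ball.mp hy; linarith)
  refine Complex.norm_fderiv_le_div_of_mapsTo_ball
    ((hd n).mono fun z hz => (hball (hsub hz)).2) (fun z hz => ?_) (by positivity)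
  rw [mem_closedBall, dist_eq_norm]
  exact (norm_sub_le _ _).trans (add_le_add (hb n z (hball (hsub hz)).1)
    (hb n y (hball (hsub (mem_ball_self (by positivity)))).1))

lemma LocallyNormallySummableOn.hasFDerivAt_tsum [CompleteSpace F] {f : ι → E → F}
    (hf : LocallyNormallySummableOn f D) (hD : IsOpen D) (hd : ∀ n, DifferentiableOn ℂ (f n) D)
    {x : E} (hx : x ∈ D) :
    HasFDerivAt (fun y => ∑' n, f n y) (∑' n, _root_.fderiv ℂ (f n) x) x := by
  obtain ⟨U, hU, M, hM, hb⟩ := hf.fderiv hD hd x hx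
  obtain ⟨r, hr, hball⟩ := Metric.mem_nhds_iff.mp (inter_mem hU (hD.mem_nhds hx))
  have : NormedSpace ℝ E := NormedSpace.restrictScalars ℝ ℂ E
  exact hasFDerivAt_tsum_of_isPreconnected hM isOpen_ball (convex_ball x r).isPreconnected
    (fun n y hy => ((hd n).differentiableAt (hD.mem_nhds (hball hy).2)).hasFDerivAt)
    (fun n y hy => hb n y (hball hy).1) (mem_ball_self hr) (hf.summable hx) (mem_ball_self hr)

end NormalConvergence

section NormalConvergenceSmooth

open ContDiff

universe u

lemma LocallyNormallySummableOn.contDiffOn_nat {ι : Type*} {E : Type u} [NormedAddCommGroup E]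
    [NormedSpace ℂ E] {D : Set E} (hD : IsOpen D) (k : ℕ) :
    ∀ {F : Type u} [NormedAddCommGroup F] [NormedSpace ℂ F] [CompleteSpace F] {f : ι → E → F},
      LocallyNormallySummableOn f D → (∀ n, ContDiffOn ℂ ∞ (f n) D) →
      ContDiffOn ℂ k (fun x => ∑' n, f n x) D := by
  induction k with
  | zero =>
    intro F _ _ _ f hf hd
    have hd' n := (hd n).differentiableOn (by simp)
    exact contDiffOn_zero.mpr fun x hx =>
      (hf.hasFDerivAt_tsum hD hd' hx).continuousAt.continuousWithinAt
  | succ k ih =>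
    intro F _ _ _ f hf hd
    have hd' n := (hd n).differentiableOn (by simp)
    push_cast
    rw [contDiffOn_succ_iff_fderiv_of_isOpen hD]
    refine ⟨fun x hx => (hf.hasFDerivAt_tsum hD hd' hx).differentiableAt.differentiableWithinAt,
      by simp, ?_⟩
    exact (ih (hf.fderiv hD hd') fun n =>
      ((contDiffOn_infty_iff_fderiv_of_isOpen hD).mp (hd n)).2).congr
        fun x hx => (hf.hasFDerivAt_tsum hD hd' hx).fderiv

/-- The sum of a locally normally summable family of holomorphic functions is smooth. -/
lemma LocallyNormallySummableOn.contDiffOn {ι : Type*} {E F : Type u}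
    [NormedAddCommGroup E] [NormedSpace ℂ E] [NormedAddCommGroup F] [NormedSpace ℂ F] [CompleteSpace F] {D : Set E}
    {f : ι → E → F} (hf : LocallyNormallySummableOn f D) (hD : IsOpen D)
    (hd : ∀ n, ContDiffOn ℂ ∞ (f n) D) : ContDiffOn ℂ ∞ (fun x => ∑' n, f n x) D :=
  contDiffOn_infty.mpr fun k => hf.contDiffOn_nat hD k hd

end NormalConvergenceSmooth

section AppellSum

open Topology ContDiff

/-- The terms of the level three Appell sum, as functions of `(u, τ)`. -/
def appellTerm (n : ℤ) (p : ℂ × ℂ) : ℂ :=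
  (-1) ^ n * Complex.exp (π * I * (n * (3 * n + 1)) * p.2) /
    (1 - Complex.exp (2 * π * I * (p.1 + n * p.2)))

/-- The set of `(u, τ)` with `τ` in the upper half-plane at which none of the terms `appellTerm n`
with `n ∈ S` has a pole. -/
def appellDomain (S : Set ℤ) : Set (ℂ × ℂ) :=
  {p | 0 < p.2.im ∧ ∀ n : ℤ, n ∈ S → Complex.exp (2 * π * I * (p.1 + n * p.2)) ≠ 1}

lemma norm_exp_two_pi_I_mul (w : ℂ) :
    ‖Complex.exp (2 * π * I * w)‖ = Real.exp (-(2 * π * w.im)) := by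
  rw [Complex.norm_exp]
  congr 1
  simp

lemma half_le_norm_one_sub_exp {u t : ℂ} {n : ℤ} {δ S : ℝ} (hδ : 0 < δ) (ht : δ < t.im)
    (hu : |u.im| < S) (hn : (S + 1) / δ ≤ |(n : ℝ)|) :
    1 / 2 ≤ ‖1 - Complex.exp (2 * π * I * (u + n * t))‖ := by
  have hpi := Real.pi_gt_three
  rw [div_le_iff₀ hδ] at hn
  have him : (u + n * t).im = u.im + n * t.im := by simp
  have hu' := abs_lt.mp hu
  rcases le_total 0 (n : ℝ) with h0 | h0
  · rw [abs_of_nonneg h0] at hn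
    have h1 : 1 ≤ u.im + n * t.im := by nlinarith
    have h2 : Real.exp (-(2 * π * (u.im + n * t.im))) ≤ 1 / 2 := by
      rw [Real.exp_neg, one_div]
      gcongr
      nlinarith [Real.add_one_le_exp (2 * π * (u.im + n * t.im))]
    have := norm_sub_norm_le (1 : ℂ) (Complex.exp (2 * π * I * (u + n * t)))
    rw [norm_exp_two_pi_I_mul, him, norm_one] at this
    linarith
  · rw [abs_of_nonpos h0] at hn
    have h1 : 1 ≤ -(u.im + n * t.im) := by nlinarith
    have h2 : 2 ≤ Real.exp (-(2 * π * (u.im + n * t.im))) := by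
      nlinarith [Real.add_one_le_exp (-(2 * π * (u.im + n * t.im)))]
    have := norm_sub_norm_le (Complex.exp (2 * π * I * (u + n * t))) 1
    rw [norm_exp_two_pi_I_mul, him, norm_one, norm_sub_rev] at this
    linarith

lemma summable_exp_neg_mul_pentagonal {δ : ℝ} (hδ : 0 < δ) :
    Summable fun n : ℤ => Real.exp (-(π * δ * (n * (3 * n + 1)))) := by
  have h := ((summable_jacobiTheta₂_term_iff (I * δ / 2) (3 * I * δ)).mpr (by simpa)).norm
  refine h.congr fun n => ?_
  rw [norm_jacobiTheta₂_term]
  congr 1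
  simp
  ring

lemma norm_exp_pentagonal_le {t : ℂ} {δ : ℝ} (ht : δ < t.im) (n : ℤ) :
    ‖Complex.exp (π * I * (n * (3 * n + 1)) * t)‖ ≤ Real.exp (-(π * δ * (n * (3 * n + 1)))) := by
  have hn : (0 : ℝ) ≤ n * (3 * n + 1) := by
    have : 0 ≤ n * (3 * n + 1) := by
      rcases le_or_gt 0 n with h | h
      · positivity
      · nlinarith
    exact_mod_cast this
  have hre : (π * I * (n * (3 * n + 1)) * t).re = -(π * t.im * (n * (3 * n + 1))) := by
    have : (π * I * (n * (3 * n + 1)) * t : ℂ) = ((π * (n * (3 * n + 1)) : ℝ) : ℂ) * (I * t) := by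
      push_cast; ring
    rw [this, Complex.re_ofReal_mul]
    simp
    ring
  rw [Complex.norm_exp, hre]
  gcongr

lemma exists_nhds_appellTerm_bound {p : ℂ × ℂ} (hp : 0 < p.2.im) :
    ∃ U ∈ 𝓝 p, ∃ M : ℤ → ℝ, Summable M ∧ ∀ᶠ n : ℤ in cofinite, ∀ y ∈ U,
      1 - Complex.exp (2 * π * I * (y.1 + n * y.2)) ≠ 0 ∧ ‖appellTerm n y‖ ≤ M n := by
  set δ := p.2.im / 2 with hδdef
  have hδ : 0 < δ := by positivity
  set S := |p.1.im| + 1 with hS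
  refine ⟨{y | δ < y.2.im ∧ |y.1.im| < S}, ?_,
    fun n => 2 * Real.exp (-(π * δ * (n * (3 * n + 1)))),
    (summable_exp_neg_mul_pentagonal hδ).mul_left _, ?_⟩
  · refine IsOpen.mem_nhds ?_ ⟨by linarith, by linarith⟩
    have h1 : Continuous fun y : ℂ × ℂ => y.2.im := by fun_prop
    have h2 : Continuous fun y : ℂ × ℂ => |y.1.im| := by fun_prop
    exact (isOpen_lt continuous_const h1).inter (isOpen_lt h2 continuous_const)
  · have h := (tendsto_norm_cocompact_atTop.comp Int.tendsto_coe_cofinite).eventually_ge_atTop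
      ((S + 1) / δ)
    filter_upwards [h] with n hn y hy
    have hhalf := half_le_norm_one_sub_exp hδ hy.1 hy.2 hn
    refine ⟨norm_pos_iff.mp (by linarith), ?_⟩
    have hnum := norm_exp_pentagonal_le hy.1 n
    rw [appellTerm, norm_div, norm_mul, norm_zpow, norm_neg, norm_one, one_zpow, one_mul,
      div_le_iff₀ (by linarith)]
    nlinarith [Real.exp_pos (-(π * δ * (n * (3 * n + 1))))]

lemma isOpen_appellDomain (S : Set ℤ) : IsOpen (appellDomain S) := by
  refine isOpen_iff_mem_nhds.mpr fun p hp => ?_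
  obtain ⟨U, hU, M, -, hb⟩ := exists_nhds_appellTerm_bound hp.1
  have hfin := eventually_cofinite.mp hb
  have h1 : ∀ᶠ y : ℂ × ℂ in 𝓝 p, 0 < y.2.im :=
    (isOpen_lt continuous_const (by fun_prop)).mem_nhds hp.1
  have h2 : ∀ᶠ y : ℂ × ℂ in 𝓝 p, ∀ n : ℤ, n ∈ hfin.toFinset → n ∈ S →
      Complex.exp (2 * π * I * (y.1 + n * y.2)) ≠ 1 := by
    refine (eventually_all_finset hfin.toFinset).mpr fun n _ => ?_
    by_cases hn : n ∈ S
    · have hc : Continuous fun y : ℂ × ℂ => Complex.exp (2 * π * I * (y.1 + n * y.2)) := by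
        fun_prop
      filter_upwards [hc.continuousAt.eventually_ne (hp.2 n hn)] with y hy _ using hy
    · exact Eventually.of_forall fun y h => absurd h hn
  filter_upwards [h1, h2, hU] with y hy1 hy2 hyU
  refine ⟨hy1, fun n hn => ?_⟩
  by_cases hmem : n ∈ hfin.toFinset
  · exact hy2 n hmem hn
  · have : ∀ y ∈ U, 1 - Complex.exp (2 * π * I * (y.1 + n * y.2)) ≠ 0 ∧ ‖appellTerm n y‖ ≤ M n := by
      simpa using hmem
    exact (sub_ne_zero.mp (this y hyU).1).symm

lemma contDiffOn_appellTerm {S : Set ℤ} {n : ℤ} (hn : n ∈ S) :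
    ContDiffOn ℂ ∞ (appellTerm n) (appellDomain S) :=
  ContDiffOn.div (ContDiff.contDiffOn (by fun_prop)) (ContDiff.contDiffOn (by fun_prop))
    fun p hp => sub_ne_zero.mpr (hp.2 n hn).symm

lemma locallyNormallySummableOn_appellTerm (S : Set ℤ) :
    LocallyNormallySummableOn (fun n : S => appellTerm n) (appellDomain S) := by
  refine .of_cofinite (fun n x hx => ((contDiffOn_appellTerm n.2).contDiffAt
    ((isOpen_appellDomain S).mem_nhds hx)).continuousAt) fun x hx => ?_
  obtain ⟨U, hU, M, hM, hb⟩ := exists_nhds_appellTerm_bound hx.1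
  refine ⟨U, hU, fun n => M n, hM.subtype S, ?_⟩
  filter_upwards [Subtype.val_injective.tendsto_cofinite.eventually hb] with n hn y hy
  exact (hn y hy).2

lemma contDiffOn_tsum_appellTerm (S : Set ℤ) :
    ContDiffOn ℂ ∞ (fun p => ∑' n : S, appellTerm n p) (appellDomain S) :=
  (locallyNormallySummableOn_appellTerm S).contDiffOn (isOpen_appellDomain S)
    fun n => contDiffOn_appellTerm n.2

lemma summable_appellTerm {p : ℂ × ℂ} (hp : p ∈ appellDomain Set.univ) :
    Summable fun n => appellTerm n p := by
  have := (locallyNormallySummableOn_appellTerm Set.univ).summable hp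
  exact (Equiv.Set.univ ℤ).summable_iff (f := fun n => appellTerm n p).mp this

/-- The normalizing factor in front of the Appell sum. -/
def appellPrefactor (p : ℂ × ℂ) : ℂ :=
  Complex.exp (π * I * p.1 - π * I * p.2 / 12) *
    (qPochInf (Complex.exp (2 * π * I * p.2)) (Complex.exp (2 * π * I * p.2)))⁻¹

/-- The normalized rank function, as a function of `(u, τ)`. -/
def rankFun (p : ℂ × ℂ) : ℂ := appellPrefactor p * ∑' n : ℤ, appellTerm n p

lemma norm_exp_two_pi_I_mul_lt_one {t : ℂ} (ht : 0 < t.im) :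
    ‖Complex.exp (2 * π * I * t)‖ < 1 := by
  rw [norm_exp_two_pi_I_mul, Real.exp_lt_one_iff]
  have := Real.pi_pos
  nlinarith [mul_pos this ht]

lemma contDiffOn_appellPrefactor :
    ContDiffOn ℂ ∞ appellPrefactor {p | 0 < p.2.im} := by
  have hopen : IsOpen {q : ℂ | ‖q‖ < 1} := isOpen_lt continuous_norm continuous_const
  have h1 : ContDiffOn ℂ ∞ (fun q : ℂ => (qPochInf q q)⁻¹) {q : ℂ | ‖q‖ < 1} := by
    refine ContDiffOn.inv ?_ fun q hq => qPochInf_self_ne_zero hq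
    have h : DifferentiableOn ℂ (fun q : ℂ => qPochInf q q) {q : ℂ | ‖q‖ < 1} := by
      have := ModularForm.differentiableOn_tprod_one_sub_pow
      simp_rw [qPochInf_self_eq]
      convert! this using 1
      ext; simp
    exact h.contDiffOn hopen
  refine ContDiffOn.mul (ContDiff.contDiffOn (by fun_prop)) ?_
  refine h1.comp (ContDiff.contDiffOn (by fun_prop))
    (g := fun q => (qPochInf q q)⁻¹) (f := fun p : ℂ × ℂ => Complex.exp (2 * π * I * p.2)) ?_
  exact fun p hp => norm_exp_two_pi_I_mul_lt_one hp

lemma contDiffOn_appellPrefactor_mul_tsum (S : Set ℤ) :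
    ContDiffOn ℂ ∞ (fun p => appellPrefactor p * ∑' n : S, appellTerm n p) (appellDomain S) :=
  (contDiffOn_appellPrefactor.mono fun _ hp => hp.1).mul (contDiffOn_tsum_appellTerm S)

lemma contDiffOn_rankFun : ContDiffOn ℂ ∞ rankFun (appellDomain Set.univ) := by
  refine (contDiffOn_appellPrefactor_mul_tsum Set.univ).congr fun p _ => ?_
  rw [tsum_univ (fun n => appellTerm n p), rankFun]

lemma rankFun_eq (u t : ℂ) : rankFun (u, t) =
    Complex.exp (π * I * u - π * I * t / 12) *
      rankStar (Complex.exp (2 * π * I * u)) (Complex.exp (2 * π * I * t)) := by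
  rw [rankFun, appellPrefactor, rankStar, mul_assoc]
  congr 2
  refine tsum_congr fun n => ?_
  obtain ⟨k, hk⟩ : (2 : ℤ) ∣ n * (3 * n + 1) := by
    rcases Int.even_or_odd' n with ⟨m, rfl | rfl⟩
    · exact ⟨m * (3 * (2 * m) + 1), by ring⟩
    · exact ⟨(2 * m + 1) * (3 * m + 2), by ring⟩
  have hk' : ((n : ℂ) * (3 * n + 1)) = 2 * k := by exact_mod_cast hk
  rw [appellTerm, hk', hk, Int.mul_ediv_cancel_left _ (by norm_num), ← Complex.exp_int_mul,
    ← Complex.exp_int_mul, ← Complex.exp_add]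
  congr 3 <;> ring_nf

end AppellSum

section HeatOperator

open Topology ContDiff

/-- The heat operator `12πi ∂/∂τ + ∂²/∂u²`. -/
def heatOp (F : ℂ × ℂ → ℂ) (p : ℂ × ℂ) : ℂ :=
  12 * π * I * deriv (fun t => F (p.1, t)) p.2 + iteratedDeriv 2 (fun w => F (w, p.2)) p.1

variable {F G : ℂ × ℂ → ℂ} {p : ℂ × ℂ} {D : Set (ℂ × ℂ)}

lemma deriv_slice_fst (h : DifferentiableAt ℂ F p) :
    deriv (fun w => F (w, p.2)) p.1 = fderiv ℂ F p (1, 0) := by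
  have h1 : HasDerivAt (fun w : ℂ => (w, p.2)) (1, 0) p.1 :=
    (hasDerivAt_id p.1).prodMk (hasDerivAt_const _ _)
  exact (HasFDerivAt.comp_hasDerivAt p.1 h.hasFDerivAt h1).deriv

lemma deriv_slice_snd (h : DifferentiableAt ℂ F p) :
    deriv (fun t => F (p.1, t)) p.2 = fderiv ℂ F p (0, 1) := by
  have h1 : HasDerivAt (fun t : ℂ => (p.1, t)) (0, 1) p.2 :=
    (hasDerivAt_const _ _).prodMk (hasDerivAt_id p.2)
  exact (HasFDerivAt.comp_hasDerivAt p.2 h.hasFDerivAt h1).deriv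

lemma ContDiffAt.fderiv_apply_const (h : ContDiffAt ℂ ∞ F p) (v : ℂ × ℂ) :
    ContDiffAt ℂ ∞ (fun q => fderiv ℂ F q v) p :=
  (h.fderiv_right (m := ∞) (by simp)).clm_apply contDiffAt_const

lemma eventually_differentiableAt (h : ContDiffAt ℂ ∞ F p) :
    ∀ᶠ q in 𝓝 p, DifferentiableAt ℂ F q := by
  filter_upwards [(h.of_le (m := 1) (by exact_mod_cast le_top)).eventually (by simp)] with q hq
  exact hq.differentiableAt (by simp)

lemma heatOp_eq (h : ContDiffAt ℂ ∞ F p) : heatOp F p =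
    12 * π * I * fderiv ℂ F p (0, 1) + fderiv ℂ (fun q => fderiv ℂ F q (1, 0)) p (1, 0) := by
  rw [heatOp, deriv_slice_snd (h.differentiableAt (by simp)),
    ← deriv_slice_fst ((h.fderiv_apply_const (1, 0)).differentiableAt (by simp)), iteratedDeriv_succ,
    iteratedDeriv_one]
  congr 1
  refine EventuallyEq.deriv_eq ?_
  have hc : ContinuousAt (fun w : ℂ => (w, p.2)) p.1 := by fun_prop
  filter_upwards [hc.eventually (eventually_differentiableAt h)] with w hw
  exact deriv_slice_fst (p := (w, p.2)) hw

lemma heatOp_congr (h : F =ᶠ[𝓝 p] G) : heatOp F p = heatOp G p := by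
  have h1 : ContinuousAt (fun w : ℂ => (w, p.2)) p.1 := by fun_prop
  have h2 : ContinuousAt (fun t : ℂ => (p.1, t)) p.2 := by fun_prop
  rw [heatOp, heatOp]
  congr 1
  · exact congrArg _ (EventuallyEq.deriv_eq (h2.tendsto.eventually h))
  · exact EventuallyEq.iteratedDeriv_eq 2 (h1.tendsto.eventually h)

lemma contDiffOn_heatOp (hD : IsOpen D) (h : ContDiffOn ℂ ∞ F D) :
    ContDiffOn ℂ ∞ (heatOp F) D := by
  intro p hp
  have hp' := h.contDiffAt (hD.mem_nhds hp)
  have hs : ContDiffAt ℂ ∞ (fun q => 12 * π * I * fderiv ℂ F q (0, 1) +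
      fderiv ℂ (fun q => fderiv ℂ F q (1, 0)) q (1, 0)) p :=
    (contDiffAt_const.mul (hp'.fderiv_apply_const (0, 1))).add
      ((hp'.fderiv_apply_const (1, 0)).fderiv_apply_const (1, 0))
  refine (hs.congr_of_eventuallyEq ?_).contDiffWithinAt
  filter_upwards [hD.mem_nhds hp] with q hq using heatOp_eq (h.contDiffAt (hD.mem_nhds hq))

lemma heatOp_add (hF : ContDiffAt ℂ ∞ F p) (hG : ContDiffAt ℂ ∞ G p) :
    heatOp (fun q => F q + G q) p = heatOp F p + heatOp G p := by
  have h2 : (fun q => fderiv ℂ (fun q => F q + G q) q (1, 0)) =ᶠ[𝓝 p]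
      fun q => fderiv ℂ F q (1, 0) + fderiv ℂ G q (1, 0) := by
    filter_upwards [eventually_differentiableAt hF, eventually_differentiableAt hG] with q h1 h2
    rw [fderiv_fun_add h1 h2]; rfl
  rw [heatOp_eq hF, heatOp_eq hG, heatOp_eq (hF.add hG), h2.fderiv_eq,
    fderiv_fun_add (hF.differentiableAt (by simp)) (hG.differentiableAt (by simp)),
    fderiv_fun_add ((hF.fderiv_apply_const _).differentiableAt (by simp))
      ((hG.fderiv_apply_const _).differentiableAt (by simp))]
  simp only [_root_.add_apply]
  ring

lemma heatOp_neg : heatOp (fun q => -F q) p = -heatOp F p := by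
  rw [heatOp, heatOp, deriv.fun_neg, iteratedDeriv_fun_neg]
  ring

lemma fderiv_exp_mul_comp (l : ℂ × ℂ →L[ℂ] ℂ) (L : ℂ × ℂ →L[ℂ] ℂ × ℂ)
    (h : DifferentiableAt ℂ F (L p)) (v : ℂ × ℂ) :
    fderiv ℂ (fun q => Complex.exp (l q) * F (L q)) p v =
      Complex.exp (l p) * (l v * F (L p) + fderiv ℂ F (L p) (L v)) := by
  have h1 : HasFDerivAt (fun q => Complex.exp (l q)) (Complex.exp (l p) • l) p :=
    l.hasFDerivAt.cexp
  have h2 : HasFDerivAt (fun q => F (L q)) ((fderiv ℂ F (L p)).comp L) p :=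
    h.hasFDerivAt.comp p L.hasFDerivAt
  rw [(h1.fun_mul h2).fderiv]
  simp
  ring

/-- The heat operator acting on an exponential multiple of a function composed with a linear
map fixing `(1, 0)`. -/
lemma heatOp_exp_mul_comp (l : ℂ × ℂ →L[ℂ] ℂ) (L : ℂ × ℂ →L[ℂ] ℂ × ℂ) (hL : L (1, 0) = (1, 0))
    (hF : ContDiffAt ℂ ∞ F (L p)) :
    heatOp (fun q => Complex.exp (l q) * F (L q)) p = Complex.exp (l p) *
      (12 * π * I * (l (0, 1) * F (L p) + fderiv ℂ F (L p) (L (0, 1))) +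
        l (1, 0) ^ 2 * F (L p) + 2 * l (1, 0) * fderiv ℂ F (L p) (1, 0) +
          fderiv ℂ (fun q => fderiv ℂ F q (1, 0)) (L p) (1, 0)) := by
  have hd : DifferentiableAt ℂ F (L p) := hF.differentiableAt (by simp)
  have hd' : DifferentiableAt ℂ (fun q => fderiv ℂ F q (1, 0)) (L p) :=
    (hF.fderiv_apply_const _).differentiableAt (by simp)
  have hG : ContDiffAt ℂ ∞ (fun q => Complex.exp (l q) * F (L q)) p :=
    l.contDiff.contDiffAt.cexp.mul (hF.comp p L.contDiff.contDiffAt)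
  have h2 : (fun q => fderiv ℂ (fun q => Complex.exp (l q) * F (L q)) q (1, 0)) =ᶠ[𝓝 p]
      fun q => Complex.exp (l q) *
        (fun x => l (1, 0) * F x + fderiv ℂ F x (1, 0)) (L q) := by
    filter_upwards [L.continuous.continuousAt.eventually (eventually_differentiableAt hF)]
      with q hq
    rw [fderiv_exp_mul_comp l L hq, hL]
  rw [heatOp_eq hG, h2.fderiv_eq, fderiv_exp_mul_comp l L hd,
    fderiv_exp_mul_comp (F := fun x => l (1, 0) * F x + fderiv ℂ F x (1, 0)) l L
      ((hd.const_mul _).add hd'), hL, fderiv_fun_add (hd.const_mul _) hd', fderiv_const_mul hd]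
  simp only [_root_.add_apply, _root_.smul_apply, smul_eq_mul]
  ring

/-- The linear form `(u, τ) ↦ a u + b τ`. -/
def linearForm (a b : ℂ) : ℂ × ℂ →L[ℂ] ℂ :=
  a • ContinuousLinearMap.fst ℂ ℂ ℂ + b • ContinuousLinearMap.snd ℂ ℂ ℂ

lemma linearForm_apply (a b : ℂ) (p : ℂ × ℂ) : linearForm a b p = a * p.1 + b * p.2 := by
  simp [linearForm]

lemma heatOp_exp_linearForm {a b : ℂ} (hab : 12 * π * I * b + a ^ 2 = 0) :
    heatOp (fun q => Complex.exp (linearForm a b q)) p = 0 := by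
  have := heatOp_exp_mul_comp (F := fun _ => 1) (p := p) (linearForm a b) (.id ℂ _) rfl
    contDiffAt_const
  simp only [mul_one] at this
  rw [this]
  simp [linearForm_apply, hab]

/-- The map `(u, τ) ↦ (u + τ, τ)`. -/
def shearMap : ℂ × ℂ →L[ℂ] ℂ × ℂ :=
  (ContinuousLinearMap.fst ℂ ℂ ℂ + ContinuousLinearMap.snd ℂ ℂ ℂ).prod
    (ContinuousLinearMap.snd ℂ ℂ ℂ)

lemma shearMap_apply (p : ℂ × ℂ) : shearMap p = (p.1 + p.2, p.2) := rfl

lemma heatOp_shear (hF : ContDiffAt ℂ ∞ F (shearMap p)) :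
    heatOp (fun q => Complex.exp (linearForm (-6 * π * I) (-3 * π * I) q) * F (shearMap q)) p =
      Complex.exp (linearForm (-6 * π * I) (-3 * π * I) p) * heatOp F (shearMap p) := by
  have h : shearMap (0, 1) = (1, 0) + (0, 1) := by simp [shearMap_apply]
  rw [heatOp_exp_mul_comp _ _ (by simp [shearMap_apply]) hF, heatOp_eq hF, h, map_add]
  simp only [linearForm_apply]
  ring_nf

lemma heatOp_comp_add_one (p : ℂ × ℂ) :
    heatOp (fun q => F (q.1 + 1, q.2)) p = heatOp F (p.1 + 1, p.2) := by
  rw [heatOp, heatOp]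
  congr 1
  exact congrFun (iteratedDeriv_comp_add_const 2 (fun w => F (w, p.2)) 1) p.1

end HeatOperator

section AppellShift

/-- The terms of the alternating theta series of `q ^ ((3 n² + b n) / 2)`. -/
def altThetaTerm (b : ℤ) (t : ℂ) (n : ℤ) : ℂ :=
  (-1) ^ n * Complex.exp (π * I * (n * (3 * n + b)) * t)

lemma neg_one_zpow_eq_exp (n : ℤ) : (-1 : ℂ) ^ n = Complex.exp (π * I * n) := by
  rw [← Complex.exp_pi_mul_I, ← Complex.exp_int_mul]
  ring_nf

lemma summable_altThetaTerm (b : ℤ) {t : ℂ} (ht : 0 < t.im) : Summable (altThetaTerm b t) := by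
  refine ((summable_jacobiTheta₂_term_iff (1 / 2 + b * t / 2) (3 * t)).mpr (by simpa)).congr
    fun n => ?_
  rw [altThetaTerm, neg_one_zpow_eq_exp, ← Complex.exp_add, jacobiTheta₂_term]
  ring_nf

lemma hasSum_altThetaTerm_one {t : ℂ} (ht : 0 < t.im) :
    HasSum (altThetaTerm 1 t) (qPochInf (Complex.exp (2 * π * I * t))
      (Complex.exp (2 * π * I * t))) := by
  have h (n : ℤ) : altThetaTerm 1 t n =
      tripleTerm (Complex.exp (2 * π * I * t) ^ 3) (Complex.exp (2 * π * I * t))⁻¹ n := by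
    obtain ⟨k, hk⟩ : (2 : ℤ) ∣ n * (n + 1) := (Int.even_mul_succ_self n).two_dvd
    have hk' : (n : ℂ) * (n + 1) = 2 * k := by exact_mod_cast hk
    rw [altThetaTerm, tripleTerm, hk, Int.mul_ediv_cancel_left _ (by norm_num), mul_assoc,
      ← Complex.exp_neg, ← Complex.exp_nat_mul, ← Complex.exp_int_mul, ← Complex.exp_int_mul,
      mul_assoc ((-1) ^ n), ← Complex.exp_add]
    congr 2
    push_cast
    linear_combination 3 * π * I * t * hk'
  have hs := summable_altThetaTerm 1 ht
  rw [← tsum_tripleTerm_cube (norm_exp_two_pi_I_mul_lt_one ht) (Complex.exp_ne_zero _)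
    (hs.congr fun n => h n), ← tsum_congr h]
  exact hs.hasSum

lemma altThetaTerm_neg (b : ℤ) (t : ℂ) (n : ℤ) : altThetaTerm b t (-n) = altThetaTerm (-b) t n := by
  rw [altThetaTerm, altThetaTerm, zpow_neg, ← inv_zpow, inv_neg_one]
  push_cast
  ring_nf

lemma altThetaTerm_one_sub (b : ℤ) (t : ℂ) (n : ℤ) :
    altThetaTerm b t (1 - n) =
      -Complex.exp (π * I * (3 + b) * t) * altThetaTerm (-6 - b) t n := by
  have h : π * I * (((1 - n : ℤ) : ℂ) * (3 * ((1 - n : ℤ) : ℂ) + b)) * t =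
      π * I * (3 + b) * t + π * I * (n * (3 * n + ((-6 - b : ℤ) : ℂ))) * t := by
    push_cast; ring
  rw [altThetaTerm, altThetaTerm, h, Complex.exp_add, zpow_sub₀ (by norm_num), div_eq_mul_inv,
    ← inv_zpow, inv_neg_one]
  ring

lemma hasSum_altThetaTerm_neg_one {t : ℂ} (ht : 0 < t.im) :
    HasSum (altThetaTerm (-1) t) (qPochInf (Complex.exp (2 * π * I * t))
      (Complex.exp (2 * π * I * t))) := by
  have h := (Equiv.neg ℤ).hasSum_iff.mpr (hasSum_altThetaTerm_one ht)
  exact (funext (altThetaTerm_neg 1 t)) ▸ h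

lemma tsum_altThetaTerm_one_sub (b : ℤ) (t : ℂ) : ∑' n, altThetaTerm b t n =
    -Complex.exp (π * I * (3 + b) * t) * ∑' n, altThetaTerm (-6 - b) t n := by
  rw [← (Equiv.subLeft (1 : ℤ)).tsum_eq, ← tsum_mul_left]
  exact tsum_congr fun n => altThetaTerm_one_sub b t n

lemma hasSum_altThetaTerm_neg_three {t : ℂ} (ht : 0 < t.im) :
    HasSum (altThetaTerm (-3) t) 0 := by
  have h := tsum_altThetaTerm_one_sub (-3) t
  norm_num at h
  rw [← self_eq_neg.mp h]
  exact (summable_altThetaTerm (-3) ht).hasSum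

lemma hasSum_altThetaTerm_neg_five {t : ℂ} (ht : 0 < t.im) :
    HasSum (altThetaTerm (-5) t) (-(Complex.exp (2 * π * I * t))⁻¹ *
      qPochInf (Complex.exp (2 * π * I * t)) (Complex.exp (2 * π * I * t))) := by
  have h := tsum_altThetaTerm_one_sub (-5) t
  norm_num [(hasSum_altThetaTerm_neg_one ht).tsum_eq] at h
  have h2 := (summable_altThetaTerm (-5) ht).hasSum
  rw [h] at h2
  convert! h2 using 1
  rw [← Complex.exp_neg]
  ring_nf

lemma appellTerm_shear (n : ℤ) {u t : ℂ}
    (hn : Complex.exp (2 * π * I * (u + n * t)) ≠ 1) :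
    appellTerm (n - 1) (u + t, t) =
      -Complex.exp (2 * π * I * t) * (Complex.exp (2 * π * I * u) ^ 3 * appellTerm n (u, t) +
        altThetaTerm (-5) t n + Complex.exp (2 * π * I * u) * altThetaTerm (-3) t n +
          Complex.exp (2 * π * I * u) ^ 2 * altThetaTerm (-1) t n) := by
  have h0 : π * I * (((n - 1 : ℤ) : ℂ) * (3 * ((n - 1 : ℤ) : ℂ) + 1)) * t =
      π * I * (n * (3 * n + 1)) * t + 2 * π * I * t - (3 : ℕ) * (2 * π * I * (n * t)) := by
    push_cast; ring
  have h1 : 2 * π * I * (u + t + ((n - 1 : ℤ) : ℂ) * t) =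
      2 * π * I * u + 2 * π * I * (n * t) := by push_cast; ring
  have h5 : π * I * (n * (3 * n + ((-5 : ℤ) : ℂ))) * t =
      π * I * (n * (3 * n + 1)) * t - (3 : ℕ) * (2 * π * I * (n * t)) := by push_cast; ring
  have h3 : π * I * (n * (3 * n + ((-3 : ℤ) : ℂ))) * t =
      π * I * (n * (3 * n + 1)) * t - (2 : ℕ) * (2 * π * I * (n * t)) := by push_cast; ring
  have h2 : π * I * (n * (3 * n + ((-1 : ℤ) : ℂ))) * t =
      π * I * (n * (3 * n + 1)) * t - 2 * π * I * (n * t) := by push_cast; ring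
  have hX := Complex.exp_ne_zero (2 * π * I * (n * t))
  rw [mul_add, Complex.exp_add] at hn
  simp only [appellTerm, altThetaTerm]
  rw [h0, h1, h2, h3, h5, mul_add (2 * π * I) u, Complex.exp_sub, Complex.exp_sub,
    Complex.exp_sub, Complex.exp_sub, Complex.exp_nat_mul, Complex.exp_nat_mul, Complex.exp_add,
    Complex.exp_add (2 * π * I * u), zpow_sub_one₀ (by norm_num)]
  generalize Complex.exp (2 * π * I * (n * t)) = X at *
  generalize Complex.exp (2 * π * I * u) = z at *
  have hd : 1 - X * z ≠ 0 := sub_ne_zero.mpr (mul_comm z X ▸ hn.symm)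
  field_simp
  ring

lemma tsum_appellTerm_shear {u t : ℂ} (h : (u, t) ∈ appellDomain Set.univ) :
    ∑' n, appellTerm n (u + t, t) =
      -Complex.exp (2 * π * I * t) * Complex.exp (2 * π * I * u) ^ 3 * ∑' n, appellTerm n (u, t) +
        qPochInf (Complex.exp (2 * π * I * t)) (Complex.exp (2 * π * I * t)) *
          (1 - Complex.exp (2 * π * I * t) * Complex.exp (2 * π * I * u) ^ 2) := by
  have hsum := (((((summable_appellTerm h).hasSum.mul_left (Complex.exp (2 * π * I * u) ^ 3)).add
    (hasSum_altThetaTerm_neg_five h.1)).add ((hasSum_altThetaTerm_neg_three h.1).mul_left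
      (Complex.exp (2 * π * I * u)))).add ((hasSum_altThetaTerm_neg_one h.1).mul_left
        (Complex.exp (2 * π * I * u) ^ 2))).mul_left (-Complex.exp (2 * π * I * t))
  have hshift : ∑' n, appellTerm n (u + t, t) = ∑' n, appellTerm (n - 1) (u + t, t) :=
    ((Equiv.subRight (1 : ℤ)).tsum_eq fun n => appellTerm n (u + t, t)).symm
  rw [hshift, tsum_congr fun n => appellTerm_shear n (h.2 n trivial), hsum.tsum_eq]
  have hq := Complex.exp_ne_zero (2 * π * I * t)
  generalize Complex.exp (2 * π * I * t) = q at *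
  field_simp
  ring

lemma rankFun_shear {p : ℂ × ℂ} (hp : p ∈ appellDomain Set.univ) :
    Complex.exp (linearForm (-6 * π * I) (-3 * π * I) p) * rankFun (shearMap p) =
      -rankFun p + Complex.exp (linearForm (-5 * π * I) (-25 * π * I / 12) p) +
        -Complex.exp (linearForm (-π * I) (-π * I / 12) p) := by
  obtain ⟨u, t⟩ := p
  have hP := qPochInf_self_ne_zero (norm_exp_two_pi_I_mul_lt_one hp.1)
  simp only [linearForm_apply, shearMap_apply, rankFun, appellPrefactor,
    tsum_appellTerm_shear hp] at hP ⊢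
  have hE : Complex.exp (-6 * π * I * u + -3 * π * I * t) *
      Complex.exp (π * I * (u + t) - π * I * t / 12) =
      Complex.exp (-5 * π * I * u + -25 * π * I / 12 * t) := by
    rw [← Complex.exp_add]; ring_nf
  have h1 : Complex.exp (-5 * π * I * u + -25 * π * I / 12 * t) * (Complex.exp (2 * π * I * t) *
      Complex.exp (2 * π * I * u) ^ 3) = Complex.exp (π * I * u - π * I * t / 12) := by
    rw [← Complex.exp_nat_mul, ← Complex.exp_add, ← Complex.exp_add]; push_cast; ring_nf
  have h2 : Complex.exp (-5 * π * I * u + -25 * π * I / 12 * t) * (Complex.exp (2 * π * I * t) *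
      Complex.exp (2 * π * I * u) ^ 2) = Complex.exp (-π * I * u + -π * I / 12 * t) := by
    rw [← Complex.exp_nat_mul, ← Complex.exp_add, ← Complex.exp_add]; push_cast; ring_nf
  rw [← mul_assoc, ← mul_assoc, hE, ← h1, ← h2]
  generalize qPochInf _ _ = P at *
  field_simp
  ring

lemma mem_appellDomain_univ_iff {u t : ℂ} : (u, t) ∈ appellDomain Set.univ ↔
    0 < t.im ∧ ∀ m n : ℤ, u ≠ m * t + n := by
  refine and_congr_right fun _ => ⟨fun h m n hu => h (-m) trivial ?_, fun h m _ hu => ?_⟩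
  · rw [Complex.exp_eq_one_iff]
    refine ⟨n, ?_⟩
    simp only [hu]
    push_cast
    ring
  · obtain ⟨n, hn⟩ := Complex.exp_eq_one_iff.mp hu
    refine h (-m) n ?_
    have hpi : 2 * π * I ≠ 0 := Complex.two_pi_I_ne_zero
    have : u + m * t = n := mul_left_cancel₀ hpi (by linear_combination hn)
    push_cast
    linear_combination this

end AppellShift

section QuasiPeriodicity

open Topology ContDiff

lemma heatOp_rankFun_shear {p : ℂ × ℂ} (hp : p ∈ appellDomain Set.univ)
    (hp' : shearMap p ∈ appellDomain Set.univ) :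
    Complex.exp (linearForm (-6 * π * I) (-3 * π * I) p) * heatOp rankFun (shearMap p) =
      -heatOp rankFun p := by
  have hopen := isOpen_appellDomain Set.univ
  have hF := contDiffOn_rankFun.contDiffAt (hopen.mem_nhds hp)
  have hexp (a b : ℂ) : ContDiffAt ℂ ∞ (fun q => Complex.exp (linearForm a b q)) p :=
    (linearForm a b).contDiff.contDiffAt.cexp
  have hD : ∀ᶠ q in 𝓝 p, q ∈ appellDomain Set.univ := hopen.mem_nhds hp
  rw [← heatOp_shear (contDiffOn_rankFun.contDiffAt (hopen.mem_nhds hp')),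
    heatOp_congr (hD.mono fun q hq => rankFun_shear hq),
    heatOp_add (hF.neg.add (hexp _ _)) (hexp _ _).neg, heatOp_add hF.neg (hexp _ _), heatOp_neg,
    heatOp_neg, heatOp_exp_linearForm, heatOp_exp_linearForm, neg_zero, add_zero, add_zero]
  all_goals
    ring

lemma rankFun_add_one (u t : ℂ) : rankFun (u + 1, t) = -rankFun (u, t) := by
  have h (n : ℤ) : Complex.exp (2 * π * I * (u + 1 + n * t)) =
      Complex.exp (2 * π * I * (u + n * t)) := by
    rw [show 2 * π * I * (u + 1 + n * t) = 2 * π * I * (u + n * t) + 2 * π * I by ring,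
      Complex.exp_add, Complex.exp_two_pi_mul_I, mul_one]
  have h' : Complex.exp (π * I * (u + 1) - π * I * t / 12) =
      -Complex.exp (π * I * u - π * I * t / 12) := by
    rw [show π * I * (u + 1) - π * I * t / 12 = π * I * u - π * I * t / 12 + π * I by ring,
      Complex.exp_add, Complex.exp_pi_mul_I, mul_neg_one]
  simp only [rankFun, appellPrefactor, appellTerm, h, h']
  ring

lemma heatOp_rankFun_add_one (u t : ℂ) :
    heatOp rankFun (u + 1, t) = -heatOp rankFun (u, t) := by
  rw [← heatOp_neg, ← heatOp_comp_add_one (F := rankFun) (u, t)]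
  congr 1
  exact funext fun q => rankFun_add_one q.1 q.2

lemma jTheta_eq (u τ : ℂ) : jTheta u τ =
    Complex.exp (π * I * τ / 4 + π * I * (u + 1 / 2)) * jacobiTheta₂ (u + 1 / 2 + τ / 2) τ := by
  rw [jTheta, jacobiTheta₂, ← tsum_mul_left]
  refine tsum_congr fun n => ?_
  rw [jacobiTheta₂_term, ← Complex.exp_add]
  ring_nf

lemma jTheta_add_one (u τ : ℂ) : jTheta (u + 1) τ = -jTheta u τ := by
  rw [jTheta_eq, jTheta_eq, show u + 1 + 1 / 2 + τ / 2 = u + 1 / 2 + τ / 2 + 1 by ring,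
    jacobiTheta₂_add_left, show π * I * τ / 4 + π * I * (u + 1 + 1 / 2) =
      π * I * τ / 4 + π * I * (u + 1 / 2) + π * I by ring, Complex.exp_add _ (π * I),
    Complex.exp_pi_mul_I]
  ring

lemma jTheta_add_self (u τ : ℂ) :
    jTheta (u + τ) τ = -Complex.exp (-2 * π * I * u - π * I * τ) * jTheta u τ := by
  rw [jTheta_eq, jTheta_eq, show u + τ + 1 / 2 + τ / 2 = u + 1 / 2 + τ / 2 + τ by ring,
    jacobiTheta₂_add_left', ← mul_assoc, ← mul_assoc, ← Complex.exp_add,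
    ← mul_neg_one (Complex.exp _), ← Complex.exp_pi_mul_I, ← Complex.exp_add, ← Complex.exp_add]
  congr 1
  rw [Complex.exp_eq_exp_iff_exists_int]
  exact ⟨-1, by push_cast; ring⟩

lemma differentiable_jTheta {τ : ℂ} (hτ : 0 < τ.im) : Differentiable ℂ fun u => jTheta u τ := by
  simp_rw [jTheta_eq]
  intro u
  have h := (differentiableAt_jacobiTheta₂_fst (u + 1 / 2 + τ / 2) hτ).comp u
    (f := fun u => u + 1 / 2 + τ / 2) (by fun_prop)
  exact DifferentiableAt.mul (by fun_prop) h

lemma jacobiTheta₂_half_add_half (τ : ℂ) : jacobiTheta₂ (1 / 2 + τ / 2) τ = 0 := by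
  have h1 := jacobiTheta₂_add_left' (-(1 / 2 + τ / 2) + 1) τ
  rw [jacobiTheta₂_add_left, jacobiTheta₂_neg_left,
    show -(1 / 2 + τ / 2) + 1 + τ = 1 / 2 + τ / 2 by ring,
    show -π * I * (τ + 2 * (-(1 / 2 + τ / 2) + 1)) = -(π * I) by ring, Complex.exp_neg,
    Complex.exp_pi_mul_I, inv_neg_one, neg_one_mul] at h1
  exact self_eq_neg.mp h1

lemma jTheta_zero (τ : ℂ) : jTheta 0 τ = 0 := by
  rw [jTheta_eq, zero_add, jacobiTheta₂_half_add_half, mul_zero]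

lemma dedekindEta_eq (τ : ℂ) : dedekindEta τ = Complex.exp (π * I * τ / 12) *
    qPochInf (Complex.exp (2 * π * I * τ)) (Complex.exp (2 * π * I * τ)) := by
  rw [dedekindEta, qPochInf_self_eq]
  congr 1
  refine tprod_congr fun n => ?_
  rw [← Complex.exp_nat_mul]
  push_cast
  ring_nf

lemma jacobiTheta₂'_half_add_half {τ : ℂ} (hτ : 0 < τ.im) :
    jacobiTheta₂' (1 / 2 + τ / 2) τ = 2 * π * I * qPochInf (Complex.exp (2 * π * I * τ))
      (Complex.exp (2 * π * I * τ)) ^ 3 := by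
  have h (n : ℤ) : jacobiTheta₂'_term n (1 / 2 + τ / 2) τ =
      2 * π * I * (n * tripleTerm (Complex.exp (2 * π * I * τ)) 1 n) := by
    obtain ⟨k, hk⟩ : (2 : ℤ) ∣ n * (n + 1) := (Int.even_mul_succ_self n).two_dvd
    have hk' : (n : ℂ) * (n + 1) = 2 * k := by exact_mod_cast hk
    rw [jacobiTheta₂'_term, jacobiTheta₂_term, tripleTerm, hk,
      Int.mul_ediv_cancel_left _ (by norm_num), one_zpow, mul_one, neg_one_zpow_eq_exp,
      ← Complex.exp_int_mul, ← Complex.exp_add, mul_assoc (2 * π * I)]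
    congr 3
    linear_combination π * I * τ * hk'
  have hs := (hasSum_jacobiTheta₂'_term (1 / 2 + τ / 2) hτ).summable
  have hs' : Summable fun n : ℤ => n * tripleTerm (Complex.exp (2 * π * I * τ)) 1 n :=
    (summable_mul_left_iff Complex.two_pi_I_ne_zero).mp (hs.congr h)
  rw [← tsum_mul_tripleTerm_one (norm_exp_two_pi_I_mul_lt_one hτ) (Complex.exp_ne_zero _) hs',
    ← tsum_mul_left]
  exact tsum_congr h

lemma hasDerivAt_jTheta_zero {τ : ℂ} (hτ : 0 < τ.im) :
    HasDerivAt (fun u => jTheta u τ) (-2 * π * dedekindEta τ ^ 3) 0 := by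
  have h1 : HasDerivAt (fun u : ℂ => Complex.exp (π * I * τ / 4 + π * I * (u + 1 / 2)))
      (deriv (fun u : ℂ => Complex.exp (π * I * τ / 4 + π * I * (u + 1 / 2))) 0) 0 :=
    DifferentiableAt.hasDerivAt (by fun_prop)
  have h2 : HasDerivAt (fun u : ℂ => jacobiTheta₂ (u + (1 / 2 + τ / 2)) τ)
      (jacobiTheta₂' (1 / 2 + τ / 2) τ) 0 := by
    have := hasDerivAt_jacobiTheta₂_fst (0 + (1 / 2 + τ / 2)) hτ
    simpa using this.comp_add_const 0 (1 / 2 + τ / 2)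
  have h3 : Complex.exp (π * I * τ / 4 + π * I * (0 + 1 / 2)) =
      I * Complex.exp (π * I * τ / 12) ^ 3 := by
    rw [← Complex.exp_nat_mul, Complex.exp_add, mul_comm, zero_add,
      show π * I * (1 / 2 : ℂ) = π / 2 * I by ring, Complex.exp_pi_div_two_mul_I]
    congr 2
    push_cast
    ring
  simp_rw [jTheta_eq, add_assoc]
  convert! h1.fun_mul h2 using 1
  rw [zero_add (1 / 2 + τ / 2), jacobiTheta₂_half_add_half, jacobiTheta₂'_half_add_half hτ, h3,
    dedekindEta_eq]
  ring_nf
  rw [I_sq]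
  ring

end QuasiPeriodicity

section Liouville

open Topology Function

/-- The complement of the lattice `ℤ τ + ℤ`. -/
def latticeCompl (τ : ℂ) : Set ℂ := {u | ∀ m n : ℤ, u ≠ m * τ + n}

lemma add_mem_latticeCompl {τ u : ℂ} (m n : ℤ) :
    u + (m * τ + n) ∈ latticeCompl τ ↔ u ∈ latticeCompl τ := by
  refine ⟨fun h a b hu => h (a + m) (b + n) ?_, fun h a b hu => h (a - m) (b - n) ?_⟩
  · rw [hu]; push_cast; ring
  · push_cast; linear_combination hu

/-- A continuous doubly periodic function is bounded. -/
lemma isBounded_range_of_periodic {h : ℂ → ℂ} {τ : ℂ} (hτ : 0 < τ.im) (hc : Continuous h)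
    (h1 : Periodic h 1) (h2 : Periodic h τ) : Bornology.IsBounded (Set.range h) := by
  set φ : ℝ × ℝ → ℂ := fun p => p.1 * τ + p.2
  have hK : IsCompact ((h ∘ φ) '' (Set.Icc 0 1 ×ˢ Set.Icc 0 1)) :=
    (isCompact_Icc.prod isCompact_Icc).image (by fun_prop)
  refine hK.isBounded.subset ?_
  rintro _ ⟨u, rfl⟩
  set a := u.im / τ.im with ha
  set b := u.re - a * τ.re with hb
  have hu : u = φ (Int.fract a, Int.fract b) + (⌊a⌋ * τ + ⌊b⌋ * 1) := by
    have h : u = a * τ + b := by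
      apply Complex.ext
      · simp [hb]
      · simp [ha, hτ.ne']
    rw [h]
    simp only [φ, Int.fract]
    push_cast
    ring
  refine ⟨(Int.fract a, Int.fract b), ⟨⟨Int.fract_nonneg a, (Int.fract_lt_one a).le⟩,
    Int.fract_nonneg b, (Int.fract_lt_one b).le⟩, ?_⟩
  rw [comp_apply]
  conv_rhs => rw [hu]
  exact (((h2.int_mul _).add_period (h1.int_mul _)) _).symm

/-- An elliptic function with a removable singularity at `0` and no other poles is constant. -/
lemma eq_of_doublyPeriodic {τ c : ℂ} (hτ : 0 < τ.im) {g : ℂ → ℂ} (hL : IsOpen (latticeCompl τ))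
    (hL0 : ∀ᶠ u in 𝓝[≠] 0, u ∈ latticeCompl τ) (hg : DifferentiableOn ℂ g (latticeCompl τ))
    (h1 : ∀ u ∈ latticeCompl τ, g (u + 1) = g u) (h2 : ∀ u ∈ latticeCompl τ, g (u + τ) = g u)
    (hlim : Tendsto g (𝓝[≠] 0) (𝓝 c)) {u : ℂ} (hu : u ∈ latticeCompl τ) : g u = c := by
  classical
  set h : ℂ → ℂ := (latticeCompl τ).piecewise g fun _ => c with hdef
  have hmem {v : ℂ} (hv : v ∈ latticeCompl τ) : h v = g v := Set.piecewise_eq_of_mem _ _ _ hv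
  have hper1 : Periodic h 1 := fun v => by
    have := add_mem_latticeCompl (τ := τ) (u := v) 0 1
    norm_num at this
    by_cases hv : v ∈ latticeCompl τ
    · rw [hmem hv, hmem (this.mpr hv), h1 v hv]
    · simp [h, hv, this]
  have hper2 : Periodic h τ := fun v => by
    have := add_mem_latticeCompl (τ := τ) (u := v) 1 0
    norm_num at this
    by_cases hv : v ∈ latticeCompl τ
    · rw [hmem hv, hmem (this.mpr hv), h2 v hv]
    · simp [h, hv, this]
  have hdL {v : ℂ} (hv : v ∈ latticeCompl τ) : DifferentiableAt ℂ h v :=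
    (hg.differentiableAt (hL.mem_nhds hv)).congr_of_eventuallyEq <| by
      filter_upwards [hL.mem_nhds hv] with w hw using hmem hw
  have h0 : h 0 = c := by
    have : (0 : ℂ) ∉ latticeCompl τ := fun h => h 0 0 (by simp)
    simp [h, this]
  have hd0 : DifferentiableAt ℂ h 0 := by
    refine (analyticAt_of_differentiable_on_punctured_nhds_of_continuousAt
      (hL0.mono fun v hv => hdL hv) ?_).differentiableAt
    rw [continuousAt_iff_punctured_nhds, h0]
    exact hlim.congr' (hL0.mono fun v hv => (hmem hv).symm)
  have hd : Differentiable ℂ h := fun v => by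
    by_cases hv : v ∈ latticeCompl τ
    · exact hdL hv
    · simp only [latticeCompl, Set.mem_ofPred_eq, not_forall, not_not] at hv
      obtain ⟨m, n, rfl⟩ := hv
      have hp : Periodic h (m * τ + n) := by
        simpa using (hper2.int_mul m).add_period (hper1.int_mul n)
      have : h = fun w => h (w - (m * τ + n)) := funext fun w => (hp.sub_eq w).symm
      rw [this]
      exact DifferentiableAt.comp (g := h) _ (by simpa using hd0) (by fun_prop)
  rw [← hmem hu, ← h0]
  exact hd.apply_eq_apply_of_bounded
    (isBounded_range_of_periodic hτ hd.continuous hper1 hper2) u 0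

end Liouville

section LimitAtZero

open Topology ContDiff

lemma mem_appellDomain_univ {u τ : ℂ} (hτ : 0 < τ.im) :
    (u, τ) ∈ appellDomain Set.univ ↔ u ∈ latticeCompl τ :=
  mem_appellDomain_univ_iff.trans (and_iff_right hτ)

lemma isOpen_latticeCompl {τ : ℂ} (hτ : 0 < τ.im) : IsOpen (latticeCompl τ) := by
  have : latticeCompl τ = (fun u => (u, τ)) ⁻¹' appellDomain Set.univ :=
    Set.ext fun u => (mem_appellDomain_univ hτ).symm
  rw [this]
  exact (isOpen_appellDomain _).preimage (by fun_prop)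

lemma zero_mem_appellDomain_compl {τ : ℂ} (hτ : 0 < τ.im) : (0, τ) ∈ appellDomain {0}ᶜ := by
  refine ⟨hτ, fun n hn h => ?_⟩
  have h2 := congrArg norm h
  rw [norm_exp_two_pi_I_mul, norm_one, Real.exp_eq_one_iff] at h2
  simp [hτ.ne', Real.pi_ne_zero] at h2
  exact hn h2

lemma hasDerivAt_exp_pi_mul (u : ℂ) :
    HasDerivAt (fun w => Complex.exp (π * I * w)) (π * I * Complex.exp (π * I * u)) u := by
  simpa [mul_comm] using ((hasDerivAt_id u).const_mul (π * I : ℂ)).cexp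

lemma hasDerivAt_one_sub_exp_sq (u : ℂ) : HasDerivAt
    (fun w => 1 - Complex.exp (π * I * w) ^ 2) (-2 * π * I * Complex.exp (π * I * u) ^ 2) u := by
  convert! ((hasDerivAt_exp_pi_mul u).fun_pow 2).const_sub 1 using 1
  ring

lemma eventually_one_sub_exp_sq_ne_zero :
    ∀ᶠ u in 𝓝[≠] (0 : ℂ), 1 - Complex.exp (π * I * u) ^ 2 ≠ 0 :=
  (hasDerivAt_one_sub_exp_sq 0).eventually_ne (by simp [Real.pi_ne_zero])

lemma eventually_mem_latticeCompl {τ : ℂ} (hτ : 0 < τ.im) :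
    ∀ᶠ u in 𝓝[≠] 0, u ∈ latticeCompl τ := by
  have hc : ContinuousAt (fun u : ℂ => (u, τ)) 0 := by fun_prop
  have h := (hc.eventually ((isOpen_appellDomain _).mem_nhds
    (zero_mem_appellDomain_compl hτ))).filter_mono (nhdsWithin_le_nhds (s := {0}ᶜ))
  filter_upwards [h, eventually_one_sub_exp_sq_ne_zero] with u hu hu'
  refine (mem_appellDomain_univ hτ).mp ⟨hτ, fun n _ => ?_⟩
  by_cases hn : n = 0
  · subst hn
    refine fun h => hu' ?_
    rw [← Complex.exp_nat_mul, sub_eq_zero, ← h]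
    push_cast
    ring_nf
  · exact hu.2 n hn

lemma hasDerivAt_polarPart {u : ℂ} (hu : 1 - Complex.exp (π * I * u) ^ 2 ≠ 0) :
    HasDerivAt (fun w => Complex.exp (π * I * w) / (1 - Complex.exp (π * I * w) ^ 2))
      (π * I * (Complex.exp (π * I * u) + Complex.exp (π * I * u) ^ 3) /
        (1 - Complex.exp (π * I * u) ^ 2) ^ 2) u := by
  convert! (hasDerivAt_exp_pi_mul u).fun_div (hasDerivAt_one_sub_exp_sq u) hu using 1
  ring

lemma iteratedDeriv_two_polarPart {u : ℂ} (hu : 1 - Complex.exp (π * I * u) ^ 2 ≠ 0) :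
    iteratedDeriv 2 (fun w => Complex.exp (π * I * w) / (1 - Complex.exp (π * I * w) ^ 2)) u =
      -π ^ 2 * (Complex.exp (π * I * u) + 6 * Complex.exp (π * I * u) ^ 3 +
        Complex.exp (π * I * u) ^ 5) / (1 - Complex.exp (π * I * u) ^ 2) ^ 3 := by
  have h : ∀ᶠ w in 𝓝 u, 1 - Complex.exp (π * I * w) ^ 2 ≠ 0 :=
    (hasDerivAt_one_sub_exp_sq u).continuousAt.eventually_ne hu
  have he := hasDerivAt_exp_pi_mul u
  have h1 := ((he.fun_add (he.fun_pow 3)).const_mul (π * I : ℂ)).fun_div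
    ((hasDerivAt_one_sub_exp_sq u).fun_pow 2) (pow_ne_zero 2 hu)
  rw [iteratedDeriv_succ, iteratedDeriv_one,
    EventuallyEq.deriv_eq (h.mono fun w hw => (hasDerivAt_polarPart hw).deriv), h1.deriv]
  generalize Complex.exp (π * I * u) = e at *
  field_simp
  push_cast
  ring_nf
  simp only [I_sq]
  ring

lemma appellPrefactor_mul_appellTerm_zero (u t : ℂ) :
    appellPrefactor (u, t) * appellTerm 0 (u, t) = (dedekindEta t)⁻¹ *
      (Complex.exp (π * I * u) / (1 - Complex.exp (π * I * u) ^ 2)) := by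
  rw [appellPrefactor, appellTerm, dedekindEta_eq, ← Complex.exp_nat_mul, Complex.exp_sub, mul_inv]
  push_cast
  simp only [zpow_zero, zero_mul, mul_zero, Complex.exp_zero, add_zero, mul_assoc]
  ring

lemma heatOp_polarPart {u τ : ℂ} (hu : 1 - Complex.exp (π * I * u) ^ 2 ≠ 0) :
    heatOp (fun p => appellPrefactor p * appellTerm 0 p) (u, τ) =
      12 * π * I * deriv (fun t => (dedekindEta t)⁻¹) τ *
        (Complex.exp (π * I * u) / (1 - Complex.exp (π * I * u) ^ 2)) +
      (dedekindEta τ)⁻¹ * (-π ^ 2 * (Complex.exp (π * I * u) + 6 * Complex.exp (π * I * u) ^ 3 +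
        Complex.exp (π * I * u) ^ 5) / (1 - Complex.exp (π * I * u) ^ 2) ^ 3) := by
  simp only [heatOp, appellPrefactor_mul_appellTerm_zero]
  rw [deriv_mul_const_field, iteratedDeriv_const_mul_field, iteratedDeriv_two_polarPart hu]
  ring

lemma heatOp_rankFun_eq {u τ : ℂ} (hu : (u, τ) ∈ appellDomain Set.univ) :
    heatOp rankFun (u, τ) = heatOp (fun p => appellPrefactor p * appellTerm 0 p) (u, τ) +
      heatOp (fun p => appellPrefactor p * ∑' n : ({0}ᶜ : Set ℤ), appellTerm n p) (u, τ) := by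
  have hopen := isOpen_appellDomain Set.univ
  have hsub : appellDomain Set.univ ⊆ appellDomain {0}ᶜ :=
    fun p hp => ⟨hp.1, fun n _ => hp.2 n trivial⟩
  have h0 : ContDiffOn ℂ ∞ (fun p => appellPrefactor p * appellTerm 0 p)
      (appellDomain Set.univ) :=
    (contDiffOn_appellPrefactor.mono fun _ hp => hp.1).mul (contDiffOn_appellTerm trivial)
  rw [← heatOp_add (h0.contDiffAt (hopen.mem_nhds hu))
    (((contDiffOn_appellPrefactor_mul_tsum _).mono hsub).contDiffAt (hopen.mem_nhds hu))]
  refine heatOp_congr ?_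
  filter_upwards [hopen.mem_nhds hu] with p hp
  rw [← mul_add, rankFun, ← (summable_appellTerm hp).tsum_subtype_add_tsum_subtype_compl {0},
    tsum_singleton 0 (fun n => appellTerm n p)]

lemma dedekindEta_ne_zero {τ : ℂ} (hτ : 0 < τ.im) : dedekindEta τ ≠ 0 := by
  rw [dedekindEta_eq]
  exact mul_ne_zero (Complex.exp_ne_zero _)
    (qPochInf_self_ne_zero (norm_exp_two_pi_I_mul_lt_one hτ))

lemma tendsto_jTheta_div_one_sub_exp_sq {τ : ℂ} (hτ : 0 < τ.im) :
    Tendsto (fun u => jTheta u τ / (1 - Complex.exp (π * I * u) ^ 2)) (𝓝[≠] 0)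
      (𝓝 (-I * dedekindEta τ ^ 3)) := by
  have h1 := hasDerivAt_iff_tendsto_slope_zero.mp (hasDerivAt_jTheta_zero hτ)
  have h2 := hasDerivAt_iff_tendsto_slope_zero.mp (hasDerivAt_one_sub_exp_sq 0)
  have h3 := h1.div h2 (by simp [Real.pi_ne_zero])
  refine (h3.congr' ?_).trans_eq ?_
  · filter_upwards [self_mem_nhdsWithin] with u (hu : u ≠ 0)
    simp only [Pi.div_apply, zero_add, jTheta_zero, smul_eq_mul, mul_zero, Complex.exp_zero]
    field_simp
    simp
  · rw [mul_zero, Complex.exp_zero]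
    congr 1
    field_simp
    simp

lemma tendsto_jTheta_mul_heatOp_rankFun {τ : ℂ} (hτ : 0 < τ.im) :
    Tendsto (fun u => jTheta u τ ^ 3 * heatOp rankFun (u, τ)) (𝓝[≠] 0)
      (𝓝 (-8 * π ^ 2 * I * dedekindEta τ ^ 8)) := by
  have hθ : Tendsto (fun u => jTheta u τ) (𝓝[≠] 0) (𝓝 0) := by
    have := (differentiable_jTheta hτ).continuous.tendsto 0
    rw [jTheta_zero] at this
    exact this.mono_left nhdsWithin_le_nhds
  have he : Tendsto (fun u => Complex.exp (π * I * u)) (𝓝[≠] 0) (𝓝 1) := by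
    have := (hasDerivAt_exp_pi_mul 0).continuousAt.tendsto
    rw [mul_zero, Complex.exp_zero] at this
    exact this.mono_left nhdsWithin_le_nhds
  have hr := tendsto_jTheta_div_one_sub_exp_sq hτ
  have hreg : Tendsto (fun u => heatOp
      (fun p => appellPrefactor p * ∑' n : ({0}ᶜ : Set ℤ), appellTerm n p) (u, τ)) (𝓝[≠] 0)
      (𝓝 (heatOp (fun p => appellPrefactor p * ∑' n : ({0}ᶜ : Set ℤ), appellTerm n p) (0, τ))) := by
    have hopen := isOpen_appellDomain ({0}ᶜ : Set ℤ)
    have h1 : ContinuousAt (heatOp _) ((fun u : ℂ => (u, τ)) 0) := ((contDiffOn_heatOp hopen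
      (contDiffOn_appellPrefactor_mul_tsum ({0}ᶜ : Set ℤ))).contDiffAt
        (hopen.mem_nhds (zero_mem_appellDomain_compl hτ))).continuousAt
    have h2 : ContinuousAt (fun u : ℂ => (u, τ)) 0 := by fun_prop
    exact (ContinuousAt.comp (f := fun u : ℂ => (u, τ)) h1 h2).tendsto.mono_left nhdsWithin_le_nhds
  have key := ((((hθ.pow 2).mul (he.mul hr)).const_mul
    (12 * π * I * deriv (fun t => (dedekindEta t)⁻¹) τ)).add
    ((((he.add ((he.pow 3).const_mul 6)).add (he.pow 5)).mul (hr.pow 3)).const_mul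
      ((dedekindEta τ)⁻¹ * -π ^ 2))).add ((hθ.pow 3).mul hreg)
  refine (key.congr' ?_).trans_eq ?_
  · filter_upwards [eventually_one_sub_exp_sq_ne_zero, eventually_mem_latticeCompl hτ]
      with u hu hu'
    rw [heatOp_rankFun_eq ((mem_appellDomain_univ hτ).mpr hu'), heatOp_polarPart hu]
    field_simp
  · congr 1
    have := dedekindEta_ne_zero hτ
    field_simp
    ring_nf
    simp only [I_pow_three]
    ring

end LimitAtZero

lemma jTheta_mul_heatOp_rankFun {τ u : ℂ} (hτ : 0 < τ.im) (hu : u ∈ latticeCompl τ) :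
    jTheta u τ ^ 3 * heatOp rankFun (u, τ) = -8 * π ^ 2 * I * dedekindEta τ ^ 8 := by
  refine eq_of_doublyPeriodic (g := fun u => jTheta u τ ^ 3 * heatOp rankFun (u, τ)) hτ
    (isOpen_latticeCompl hτ) (eventually_mem_latticeCompl hτ) (fun v hv => ?_) (fun v hv => ?_)
    (fun v hv => ?_) (tendsto_jTheta_mul_heatOp_rankFun hτ) hu
  · have hopen := isOpen_appellDomain Set.univ
    have h1 : DifferentiableAt ℂ (heatOp rankFun) (v, τ) :=
      ((contDiffOn_heatOp hopen contDiffOn_rankFun).contDiffAt (hopen.mem_nhds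
        ((mem_appellDomain_univ hτ).mpr hv))).differentiableAt (by simp)
    exact (((differentiable_jTheta hτ v).pow 3).mul
      (h1.comp v (f := fun w => (w, τ)) (by fun_prop))).differentiableWithinAt
  · simp only [jTheta_add_one, heatOp_rankFun_add_one]
    ring
  · have hv' : v + τ ∈ latticeCompl τ := by
      have := (add_mem_latticeCompl (τ := τ) 1 0).mpr hv
      simpa using this
    have h := heatOp_rankFun_shear ((mem_appellDomain_univ hτ).mpr hv)
      ((mem_appellDomain_univ hτ).mpr hv')
    simp only [shearMap_apply, linearForm_apply] at h
    have he : Complex.exp (-6 * π * I * v + -3 * π * I * τ) =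
        Complex.exp (-2 * π * I * v - π * I * τ) ^ 3 := by
      rw [← Complex.exp_nat_mul]
      push_cast
      ring_nf
    rw [he] at h
    simp only [jTheta_add_self]
    linear_combination -jTheta v τ ^ 3 * h

/-- The Rank–Crank PDE in heat-operator form. -/
theorem rank_crank_pde_heat (τ u : ℂ) (hτ : 0 < τ.im)
    (hu : ∀ m n : ℤ, u ≠ (m : ℂ) * τ + (n : ℂ)) :
    jTheta u τ ^ 3 *
      (12 * π * I * deriv (fun t : ℂ =>
          Complex.exp (π * I * u - π * I * t / 12) *
            rankStar (Complex.exp (2 * π * I * u)) (Complex.exp (2 * π * I * t))) τ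
        + iteratedDeriv 2 (fun w : ℂ =>
          Complex.exp (π * I * w - π * I * τ / 12) *
            rankStar (Complex.exp (2 * π * I * w)) (Complex.exp (2 * π * I * τ))) u)
    = -8 * π^2 * I * dedekindEta τ ^ 8 := by
  simp_rw [← rankFun_eq]
  exact jTheta_mul_heatOp_rankFun hτ hu

end
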